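/- Suppose the quadratic form x ↦ ⟨x, T x⟩ is a Legendre form and consider the linearly constrained problem: minimize f(x) over F = {x ∈ H : ⟨c_i, x⟩ + α_i ≤ 0 for all i = 1,…,m}. If F is nonempty and f is bounded from below on F, then f attains its infimum on F. -/

import Mathlib

open scoped RealInnerProductSpace
open Filter Topology

/-- A sequence `x` in a real inner product space converges weakly to `x₀` if
`⟪a, x k⟫ → ⟪a, x₀⟫` for every `a`. -/
def WeaklyConvergesTo {H : Type*} [NormedAddCommGroup H] [InnerProductSpace ℝ H]
    (x : ℕ → H) (x₀ : H) : Prop :=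
  ∀ a : H, Tendsto (fun k => ⟪a, x k⟫) atTop (𝓝 ⟪a, x₀⟫)

/-- The quadratic form `x ↦ ⟪x, T x⟫` is a Legendre form: it is weakly sequentially lower
semicontinuous, and `x k → x₀` strongly whenever `x k ⇀ x₀` and `⟪x k, T (x k)⟫ → ⟪x₀, T x₀⟫`. -/
def IsLegendreForm {H : Type*} [NormedAddCommGroup H] [InnerProductSpace ℝ H]
    (T : H →L[ℝ] H) : Prop :=
  (∀ (x : ℕ → H) (x₀ : H), WeaklyConvergesTo x x₀ →
      ⟪x₀, T x₀⟫ ≤ Filter.liminf (fun k => ⟪x k, T (x k)⟫) Filter.atTop) ∧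
  (∀ (x : ℕ → H) (x₀ : H), WeaklyConvergesTo x x₀ →
      Tendsto (fun k => ⟪x k, T (x k)⟫) atTop (𝓝 ⟪x₀, T x₀⟫) →
      Tendsto x atTop (𝓝 x₀))

section WeakConvergence

variable {H : Type*} [NormedAddCommGroup H] [InnerProductSpace ℝ H]

/-- A bounded sequence in a Hilbert space has a weakly convergent subsequence. -/
theorem exists_subseq_weaklyConvergesTo [CompleteSpace H] (x : ℕ → H) (M : ℝ)
    (hx : ∀ k, ‖x k‖ ≤ M) :
    ∃ (x₀ : H) (φ : ℕ → ℕ), StrictMono φ ∧ WeaklyConvergesTo (x ∘ φ) x₀ := by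
  let K : Submodule ℝ H := (Submodule.span ℝ (Set.range x)).topologicalClosure
  have hK : TopologicalSpace.IsSeparable (K : Set H) := by
    rw [Submodule.topologicalClosure_coe]
    exact ((Set.countable_range x).isSeparable.span).closure
  have : TopologicalSpace.SeparableSpace K := hK.separableSpace
  have : CompleteSpace K :=
    (Submodule.isClosed_topologicalClosure _).completeSpace_coe
  have hxK : ∀ k, x k ∈ K := fun k =>
    Submodule.le_topologicalClosure _ (Submodule.subset_span ⟨k, rfl⟩)
  let z : ℕ → K := fun k => ⟨x k, hxK k⟩
  let ψ : ℕ → WeakDual ℝ K := fun k =>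
    StrongDual.toWeakDual (InnerProductSpace.toDual ℝ K (z k))
  have hψ : ∀ k, ψ k ∈ WeakDual.toStrongDual ⁻¹'
      Metric.closedBall (0 : StrongDual ℝ K) M := by
    intro k
    have : ‖InnerProductSpace.toDual ℝ K (z k)‖ ≤ M := by
      rw [LinearIsometryEquiv.norm_map]
      exact hx k
    exact mem_closedBall_zero_iff.2 this
  obtain ⟨l, -, φ, hφ, hl⟩ := WeakDual.isSeqCompact_closedBall ℝ K 0 M hψ
  let v : K := (InnerProductSpace.toDual ℝ K).symm (WeakDual.toStrongDual l)
  refine ⟨v, φ, hφ, fun a => ?_⟩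
  have h := tendsto_iff_forall_eval_tendsto_topDualPairing.1 hl
    (K.orthogonalProjectionOnto a)
  have hproj : ∀ u : K, ⟪a, (u : H)⟫ = ⟪u, K.orthogonalProjectionOnto a⟫ := fun u => by
    rw [real_inner_comm, ← Submodule.inner_orthogonalProjectionOnto_eq_of_mem_left]
  have hlim : ⟪a, (v : H)⟫ = l (K.orthogonalProjectionOnto a) := by
    rw [hproj]
    exact InnerProductSpace.toDual_symm_apply
  rw [hlim]
  exact h.congr fun k => (hproj (z (φ k))).symm

/-- The norm is weakly sequentially lower semicontinuous. -/
theorem WeaklyConvergesTo.norm_le {x : ℕ → H} {x₀ : H} (hx : WeaklyConvergesTo x x₀)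
    {b : ℕ → ℝ} {β : ℝ} (hb : Tendsto b atTop (𝓝 β)) (h : ∀ k, ‖x k‖ ≤ b k) :
    ‖x₀‖ ≤ β := by
  have hβ : 0 ≤ β := ge_of_tendsto' hb fun k => (norm_nonneg _).trans (h k)
  have h1 : ⟪x₀, x₀⟫ ≤ ‖x₀‖ * β :=
    le_of_tendsto_of_tendsto' (hx x₀) (hb.const_mul _) fun k =>
      (real_inner_le_norm _ _).trans (mul_le_mul_of_nonneg_left (h k) (norm_nonneg _))
  rw [real_inner_self_eq_norm_sq] at h1
  by_contra! hlt
  nlinarith [hβ.trans_lt hlt]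

/-- Along a bounded weakly convergent sequence, limits of upper bounds of a Legendre form are
upper bounds of its value at the weak limit. -/
theorem IsLegendreForm.inner_le {T : H →L[ℝ] H} (hT : IsLegendreForm T) {x : ℕ → H} {x₀ : H}
    (hx : WeaklyConvergesTo x x₀) {M : ℝ} (hM : ∀ k, ‖x k‖ ≤ M) {b : ℕ → ℝ} {β : ℝ}
    (hb : Tendsto b atTop (𝓝 β)) (h : ∀ k, ⟪x k, T (x k)⟫ ≤ b k) :
    ⟪x₀, T x₀⟫ ≤ β := by
  have hbelow : IsBoundedUnder (· ≥ ·) atTop fun k => ⟪x k, T (x k)⟫ := by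
    refine ⟨-(M * (‖T‖ * M)), Filter.eventually_map.2 (Filter.Eventually.of_forall fun k => ?_)⟩
    have h1 := abs_le.1 (abs_real_inner_le_norm (x k) (T (x k)))
    have h2 : ‖x k‖ * ‖T (x k)‖ ≤ M * (‖T‖ * M) := by
      have h0 : 0 ≤ M := (norm_nonneg _).trans (hM k)
      gcongr
      · exact hM k
      · exact (T.le_opNorm (x k)).trans (by gcongr; exact hM k)
    linarith [h1.1]
  calc ⟪x₀, T x₀⟫ ≤ liminf (fun k => ⟪x k, T (x k)⟫) atTop := hT.1 x x₀ hx
    _ ≤ liminf b atTop := liminf_le_liminf (Eventually.of_forall h) hbelow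
        hb.isCoboundedUnder_ge
    _ = β := hb.liminf_eq

end WeakConvergence

section Quadratic

variable {H : Type*} [NormedAddCommGroup H] [InnerProductSpace ℝ H]

/-- A sublevel set of a quadratic function with Legendre principal part on a polyhedron is
closed under weak limits of bounded sequences, even with a varying level. -/
theorem IsLegendreForm.mem_sublevel_of_weaklyConvergesTo {ι : Type*} {T : H →L[ℝ] H}
    (hT : IsLegendreForm T) (c : H) (ci : ι → H) (α : ι → ℝ) {x : ℕ → H} {x₀ : H}
    (hx : WeaklyConvergesTo x x₀) {M : ℝ} (hM : ∀ k, ‖x k‖ ≤ M) {b : ℕ → ℝ} {β : ℝ}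
    (hb : Tendsto b atTop (𝓝 β)) (hfeas : ∀ k i, ⟪ci i, x k⟫ + α i ≤ 0)
    (h : ∀ k, (1/2 : ℝ) * ⟪x k, T (x k)⟫ + ⟪c, x k⟫ ≤ b k) :
    (∀ i, ⟪ci i, x₀⟫ + α i ≤ 0) ∧ (1/2 : ℝ) * ⟪x₀, T x₀⟫ + ⟪c, x₀⟫ ≤ β := by
  refine ⟨fun i => le_of_tendsto' ((hx (ci i)).add_const _) fun k => hfeas k i, ?_⟩
  have := hT.inner_le hx hM ((hb.sub (hx c)).const_mul 2) fun k => by linarith [h k]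
  linarith

/-- A nonempty sublevel set of a quadratic function with Legendre principal part on a polyhedron
has an element of minimal norm. -/
theorem IsLegendreForm.exists_norm_minimal [CompleteSpace H] {ι : Type*} {T : H →L[ℝ] H}
    (hT : IsLegendreForm T) (c : H) (ci : ι → H) (α : ι → ℝ) (s : ℝ)
    (hne : ∃ x : H, (∀ i, ⟪ci i, x⟫ + α i ≤ 0) ∧ (1/2 : ℝ) * ⟪x, T x⟫ + ⟪c, x⟫ ≤ s) :
    ∃ x : H, ((∀ i, ⟪ci i, x⟫ + α i ≤ 0) ∧ (1/2 : ℝ) * ⟪x, T x⟫ + ⟪c, x⟫ ≤ s) ∧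
      ∀ y : H, (∀ i, ⟪ci i, y⟫ + α i ≤ 0) → (1/2 : ℝ) * ⟪y, T y⟫ + ⟪c, y⟫ ≤ s →
        ‖x‖ ≤ ‖y‖ := by
  let S : Set H := {x | (∀ i, ⟪ci i, x⟫ + α i ≤ 0) ∧ (1/2 : ℝ) * ⟪x, T x⟫ + ⟪c, x⟫ ≤ s}
  have hSne : (norm '' S).Nonempty := Set.Nonempty.image _ hne
  have hSbd : BddBelow (norm '' S) := ⟨0, by rintro _ ⟨x, -, rfl⟩; exact norm_nonneg x⟩
  have hex : ∀ k : ℕ, ∃ x ∈ S, ‖x‖ < sInf (norm '' S) + 1 / ((k : ℝ) + 1) := by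
    intro k
    obtain ⟨_, ⟨x, hx, rfl⟩, hlt⟩ :=
      exists_lt_of_csInf_lt hSne (lt_add_of_pos_right (sInf (norm '' S))
        (Nat.one_div_pos_of_nat (α := ℝ) (n := k)))
    exact ⟨x, hx, hlt⟩
  choose x hxS hxlt using hex
  have hM : ∀ k, ‖x k‖ ≤ sInf (norm '' S) + 1 := fun k => by
    have : 1 / ((k : ℝ) + 1) ≤ 1 := by
      rw [div_le_one (by positivity)]
      linarith [(Nat.cast_nonneg k : (0 : ℝ) ≤ k)]
    linarith [hxlt k]
  obtain ⟨x₀, φ, hφ, hw⟩ := exists_subseq_weaklyConvergesTo x _ hM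
  refine ⟨x₀, hT.mem_sublevel_of_weaklyConvergesTo c ci α hw (fun k => hM (φ k))
    tendsto_const_nhds (fun k => (hxS (φ k)).1) (fun k => (hxS (φ k)).2), fun y hy hys => ?_⟩
  have hlim : Tendsto (fun k : ℕ => sInf (norm '' S) + 1 / ((φ k : ℝ) + 1)) atTop
      (𝓝 (sInf (norm '' S) + 0)) :=
    ((tendsto_one_div_add_atTop_nhds_zero_nat (𝕜 := ℝ)).comp hφ.tendsto_atTop).const_add _
  have h1 := hw.norm_le hlim fun k => (hxlt (φ k)).le
  rw [add_zero] at h1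
  exact h1.trans (csInf_le hSbd ⟨y, ⟨hy, hys⟩, rfl⟩)

/-- Expansion of a quadratic function along a line. -/
theorem quadratic_add_smul {T : H →L[ℝ] H} (hT : ∀ x y : H, ⟪T x, y⟫ = ⟪x, T y⟫) (c x v : H)
    (t : ℝ) :
    (1/2 : ℝ) * ⟪x + t • v, T (x + t • v)⟫ + ⟪c, x + t • v⟫ =
      ((1/2 : ℝ) * ⟪x, T x⟫ + ⟪c, x⟫) + t * (⟪T x, v⟫ + ⟪c, v⟫) + t ^ 2 / 2 * ⟪v, T v⟫ := by
  have h : ⟪v, T x⟫ = ⟪T x, v⟫ := real_inner_comm _ _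
  simp only [map_add, map_smul, inner_add_left, inner_add_right, real_inner_smul_left,
    real_inner_smul_right, h, ← hT x v]
  ring

end Quadratic

/-- A quadratic polynomial bounded below on `[0, ∞)` has nonnegative leading coefficient. -/
theorem quadratic_coeff_nonneg_of_bddBelow {a p q L : ℝ}
    (h : ∀ t : ℝ, 0 ≤ t → L ≤ a + t * p + t ^ 2 / 2 * q) : 0 ≤ q := by
  by_contra! hq
  set A := |p| + |a - L| + 1 with hA
  set t := 1 + 2 * A / -q with ht
  have hA0 : 0 < A := by positivity
  have ht1 : 1 ≤ t := by
    have : 0 ≤ 2 * A / -q := div_nonneg (by positivity) (by linarith)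
    linarith
  have htq : t * q / 2 ≤ -A := by
    have e : t * q / 2 = q / 2 - A := by
      rw [ht]
      field_simp [hq.ne]
      ring
    linarith
  have h1 := h t (by linarith)
  have h2 : t * (t * q / 2) ≤ t * -A := mul_le_mul_of_nonneg_left htq (by linarith)
  have h3 : t * p ≤ t * |p| := mul_le_mul_of_nonneg_left (le_abs_self p) (by linarith)
  have h4 : 1 * |a - L| ≤ t * |a - L| := mul_le_mul_of_nonneg_right ht1 (abs_nonneg _)
  have h5 := le_abs_self (a - L)
  rw [hA] at h2
  linarith

/-- An affine function bounded below on `[0, ∞)` has nonnegative slope. -/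
theorem slope_nonneg_of_bddBelow {a p L : ℝ}
    (h : ∀ t : ℝ, 0 ≤ t → L ≤ a + t * p) : 0 ≤ p := by
  by_contra! hp
  have h0 := h 0 le_rfl
  have := h ((a - L + 1) / -p) (div_nonneg (by linarith) (by linarith))
  have e : (a - L + 1) / -p * p = -(a - L + 1) := by
    rw [div_neg, neg_mul, div_mul_cancel₀ _ hp.ne]
  linarith

/-- The linearly constrained case: if `⟪x, T x⟫` is a Legendre form, `F` is a nonempty set
defined by linear inequalities and `f` is bounded from below on `F`, then `f` attains its
infimum on `F`. -/
theorem frank_wolfe_linear_constraints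
    {H : Type*} [NormedAddCommGroup H] [InnerProductSpace ℝ H] [CompleteSpace H]
    {m : ℕ} (T : H →L[ℝ] H) (hT_sa : ∀ x y : H, ⟪T x, y⟫ = ⟪x, T y⟫) (c : H)
    (ci : Fin m → H) (α : Fin m → ℝ)
    (f : H → ℝ) (hf : ∀ x, f x = (1/2 : ℝ) * ⟪x, T x⟫ + ⟪c, x⟫)
    (F : Set H)
    (hF : F = {x : H | ∀ i, ⟪ci i, x⟫ + α i ≤ 0})
    (hLeg : IsLegendreForm T)
    (hne : F.Nonempty) (hbd : BddBelow (f '' F)) :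
    ∃ xbar ∈ F, ∀ x ∈ F, f xbar ≤ f x := by
  subst hF
  obtain ⟨z, hz⟩ := hne
  set L := sInf (f '' {x : H | ∀ i, ⟪ci i, x⟫ + α i ≤ 0}) with hLdef
  have hL : ∀ x, (∀ i, ⟪ci i, x⟫ + α i ≤ 0) → L ≤ f x := fun x hx =>
    csInf_le hbd ⟨x, hx, rfl⟩
  have hex : ∀ k : ℕ, ∃ x : H, ((∀ i, ⟪ci i, x⟫ + α i ≤ 0) ∧ f x ≤ L + 1 / ((k : ℝ) + 1)) ∧
      ∀ y : H, (∀ i, ⟪ci i, y⟫ + α i ≤ 0) → f y ≤ L + 1 / ((k : ℝ) + 1) → ‖x‖ ≤ ‖y‖ := by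
    intro k
    obtain ⟨_, ⟨x, hx, rfl⟩, hlt⟩ :=
      exists_lt_of_csInf_lt (Set.Nonempty.image f ⟨z, hz⟩) (lt_add_of_pos_right L
        (Nat.one_div_pos_of_nat (α := ℝ) (n := k)))
    simp only [hf]
    exact hLeg.exists_norm_minimal c ci α _ ⟨x, hx, by rw [← hf]; exact hlt.le⟩
  choose x hx hmin using hex
  have hlev : Tendsto (fun k : ℕ => L + 1 / ((k : ℝ) + 1)) atTop (𝓝 L) := by
    simpa using (tendsto_one_div_add_atTop_nhds_zero_nat (𝕜 := ℝ)).const_add L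
  by_cases hunb : Tendsto (fun k => ‖x k‖) atTop atTop
  · exfalso
    -- The normalized sequence has a weak limit `v`, a direction of recession.
    let y : ℕ → H := fun k => ‖x k‖⁻¹ • x k
    have hy1 : ∀ k, ‖y k‖ ≤ 1 := fun k => by
      simp only [y, norm_smul, norm_inv, norm_norm]
      exact inv_mul_le_one
    obtain ⟨v, φ, hφ, hw⟩ := exists_subseq_weaklyConvergesTo y 1 hy1
    have hr : Tendsto (fun k => ‖x (φ k)‖) atTop atTop := hunb.comp hφ.tendsto_atTop
    have hrinv : Tendsto (fun k => ‖x (φ k)‖⁻¹) atTop (𝓝 0) := tendsto_inv_atTop_zero.comp hr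
    have hfx : Tendsto (fun k => f (x (φ k))) atTop (𝓝 L) :=
      tendsto_of_tendsto_of_tendsto_of_le_of_le tendsto_const_nhds
        (hlev.comp hφ.tendsto_atTop) (fun k => hL _ (hx _).1) (fun k => (hx (φ k)).2)
    have hpos : ∀ᶠ k in atTop, 0 < ‖x (φ k)‖ := hr.eventually_gt_atTop 0
    have hQy : Tendsto (fun k => ⟪(y ∘ φ) k, T ((y ∘ φ) k)⟫) atTop (𝓝 0) := by
      have h1 : Tendsto (fun k => 2 * (‖x (φ k)‖⁻¹ * ‖x (φ k)‖⁻¹ * f (x (φ k))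
          - ‖x (φ k)‖⁻¹ * ⟪c, (y ∘ φ) k⟫)) atTop (𝓝 (2 * (0 * 0 * L - 0 * ⟪c, v⟫))) :=
        (((hrinv.mul hrinv).mul hfx).sub (hrinv.mul (hw c))).const_mul 2
      simp only [zero_mul, sub_zero, mul_zero] at h1
      refine h1.congr fun k => ?_
      simp only [y, Function.comp, hf, map_smul, real_inner_smul_left, real_inner_smul_right]
      ring
    have hrec : ∀ i, ⟪ci i, v⟫ ≤ 0 := fun i => by
      have h1 : Tendsto (fun k => -α i * ‖x (φ k)‖⁻¹) atTop (𝓝 (-α i * 0)) :=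
        hrinv.const_mul _
      rw [mul_zero] at h1
      refine le_of_tendsto_of_tendsto' (hw (ci i)) h1 fun k => ?_
      simp only [y, Function.comp, real_inner_smul_right]
      rw [mul_comm]
      exact mul_le_mul_of_nonneg_right (by linarith [(hx (φ k)).1 i])
        (inv_nonneg.2 (norm_nonneg _))
    have hray : ∀ w, (∀ i, ⟪ci i, w⟫ + α i ≤ 0) → ∀ t : ℝ, 0 ≤ t →
        L ≤ f w + t * (⟪T w, v⟫ + ⟪c, v⟫) + t ^ 2 / 2 * ⟪v, T v⟫ := fun w hw t ht => by
      rw [hf w, ← quadratic_add_smul hT_sa, ← hf]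
      refine hL _ fun i => ?_
      rw [inner_add_right, real_inner_smul_right]
      linarith [hw i, mul_nonpos_of_nonneg_of_nonpos ht (hrec i)]
    have hQv : ⟪v, T v⟫ = 0 :=
      le_antisymm (hLeg.inner_le hw (fun k => hy1 (φ k)) hQy fun k => le_rfl)
        (quadratic_coeff_nonneg_of_bddBelow (hray z hz))
    have hslope : ∀ w, (∀ i, ⟪ci i, w⟫ + α i ≤ 0) → 0 ≤ ⟪T w, v⟫ + ⟪c, v⟫ := fun w hw =>
      slope_nonneg_of_bddBelow (a := f w) (L := L) fun t ht => by
        simpa [hQv] using hray w hw t ht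
    -- The Legendre property upgrades the convergence, so `v` is a unit vector.
    have hstrong : Tendsto (y ∘ φ) atTop (𝓝 v) := hLeg.2 _ v hw (by rwa [hQv])
    have hv1 : ‖v‖ = 1 := by
      refine tendsto_nhds_unique hstrong.norm (tendsto_const_nhds.congr' ?_)
      filter_upwards [hpos] with k hk
      simp only [y, Function.comp, norm_smul, norm_inv, norm_norm]
      rw [inv_mul_cancel₀ hk.ne']
    have hscale : ∀ a : H, Tendsto (fun k => ‖x (φ k)‖⁻¹ * ⟪a, x (φ k)⟫) atTop (𝓝 ⟪a, v⟫) :=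
      fun a => (hw a).congr fun k => by simp only [y, Function.comp, real_inner_smul_right]
    have hfeas : ∀ᶠ k in atTop, ∀ i, ⟪ci i, x (φ k) + (-1 : ℝ) • v⟫ + α i ≤ 0 := by
      rw [eventually_all]
      intro i
      rcases (hrec i).lt_or_eq with hneg | hzero
      · have h1 : Tendsto (fun k => ‖x (φ k)‖ * (‖x (φ k)‖⁻¹ * ⟪ci i, x (φ k)⟫)) atTop atBot :=
          hr.atTop_mul_neg hneg (hscale (ci i))
        filter_upwards [hpos, h1.eventually_le_atBot (⟪ci i, v⟫ - α i)] with k hk hle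
        rw [mul_inv_cancel_left₀ hk.ne'] at hle
        rw [inner_add_right, real_inner_smul_right]
        linarith
      · refine Eventually.of_forall fun k => ?_
        rw [inner_add_right, real_inner_smul_right, hzero]
        linarith [(hx (φ k)).1 i]
    have hshort : ∀ᶠ k in atTop, 1 < ⟪v, x (φ k)⟫ := by
      have h0 : (0 : ℝ) < ⟪v, v⟫ := by rw [real_inner_self_eq_norm_sq, hv1]; norm_num
      have h1 : Tendsto (fun k => ‖x (φ k)‖ * (‖x (φ k)‖⁻¹ * ⟪v, x (φ k)⟫)) atTop atTop :=
        hr.atTop_mul_pos h0 (hscale v)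
      filter_upwards [hpos, h1.eventually_gt_atTop 1] with k hk hlt
      rwa [mul_inv_cancel_left₀ hk.ne'] at hlt
    -- Stepping back along `v` stays feasible, does not increase `f`, and decreases the norm.
    obtain ⟨k, hk1, hk2⟩ := (hfeas.and hshort).exists
    have hfle : f (x (φ k) + (-1 : ℝ) • v) ≤ f (x (φ k)) := by
      rw [hf, quadratic_add_smul hT_sa, ← hf, hQv]
      linarith [hslope _ (hx (φ k)).1]
    have hle := hmin (φ k) _ hk1 (hfle.trans (hx (φ k)).2)
    have hsq : ‖x (φ k) + (-1 : ℝ) • v‖ ^ 2 = ‖x (φ k)‖ ^ 2 - 2 * ⟪v, x (φ k)⟫ + 1 := by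
      rw [neg_one_smul, ← sub_eq_add_neg, norm_sub_sq_real, hv1, real_inner_comm]
      norm_num
    have := pow_le_pow_left₀ (norm_nonneg _) hle 2
    linarith
  · obtain ⟨M, hM⟩ : ∃ M : ℝ, ∃ᶠ k in atTop, ‖x k‖ ≤ M := by
      simp only [tendsto_atTop, not_forall] at hunb
      obtain ⟨M, hM⟩ := hunb
      exact ⟨M, (not_eventually.1 hM).mono fun k hk => (not_le.1 hk).le⟩
    obtain ⟨φ, hφ, hφM⟩ := extraction_of_frequently_atTop hM
    obtain ⟨x₀, χ, hχ, hw⟩ := exists_subseq_weaklyConvergesTo (x ∘ φ) M hφM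
    obtain ⟨h1, h2⟩ := hLeg.mem_sublevel_of_weaklyConvergesTo c ci α hw (fun k => hφM (χ k))
      (hlev.comp (hφ.comp hχ).tendsto_atTop) (fun k => (hx (φ (χ k))).1)
      (fun k => by rw [← hf]; exact (hx (φ (χ k))).2)
    rw [← hf] at h2
    exact ⟨x₀, h1, fun w hw => h2.trans (hL w hw)⟩
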